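/- arXiv:2405.04631 — 2 statements merged into one kernel-verified Lean document; each statement's English description precedes it below -/
import Mathlib

section
/- Over the field ℂ, the map φ is a homomorphism of sl_2(ℂ)-modules: φ(e·x) = e·φ(x) and φ(f·x) = f·φ(x) for every x ∈ Sym^{N−1}E ⊗ ⋀^{N+1}Sym^{d+1}E. -/
open MvPolynomial TensorProduct

set_option maxHeartbeats 1000000
set_option synthInstance.maxHeartbeats 400000

noncomputable section

/-- `Sym' F c` : the `c`-th symmetric power of `E = F²`, realised as the space of
homogeneous polynomials of degree `c` in the two variables `X = X 0`, `Y = X 1`. -/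
abbrev Sym' (F : Type*) [Field F] (c : ℕ) : Type _ :=
  ↥(MvPolynomial.homogeneousSubmodule (Fin 2) F c)

variable (F : Type*) [Field F]

/-- The basis monomial `X^(c-i) Y^i` of `Sym' F c`; it is `0` (junk) if `i > c`. -/
def XY (c i : ℕ) : Sym' F c :=
  if h : i ≤ c then
    ⟨(X 0 : MvPolynomial (Fin 2) F) ^ (c - i) * X 1 ^ i, by
      rw [MvPolynomial.mem_homogeneousSubmodule]
      have := ((isHomogeneous_X_pow (R := F) (0 : Fin 2) (c - i)).mul
        (isHomogeneous_X_pow (R := F) (1 : Fin 2) i))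
      rwa [Nat.sub_add_cancel h] at this⟩
  else 0

/-- `F_∧^{(c)}(k) = X^{c-k₁}Y^{k₁} ∧ ⋯ ∧ X^{c-k_r}Y^{k_r}` in `⋀^r (Sym' F c)`. -/
def wedge (c : ℕ) {r : ℕ} (k : Fin r → ℕ) : ⋀[F]^r (Sym' F c) :=
  ⟨ExteriorAlgebra.ιMulti F r fun a => XY F c (k a),
    ExteriorAlgebra.ιMulti_range F r (Set.mem_range_self _)⟩

/-- `F(i,j) = F_∧^{(d)}(i) ⊗ X^{d-j}Y^j`. -/
def Fp (d : ℕ) {N : ℕ} (i : Fin N → ℕ) (j : ℕ) :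
    (⋀[F]^N (Sym' F d)) ⊗[F] (Sym' F d) :=
  wedge F d i ⊗ₜ[F] XY F d j

/-- The multiplication map `μ_N : ⋀^N V ⊗ V → ⋀^{N+1} V` for `V = Sym' F c`. -/
def mu (c N : ℕ) :
    ((⋀[F]^N (Sym' F c)) ⊗[F] (Sym' F c)) →ₗ[F] ⋀[F]^(N + 1) (Sym' F c) :=
  TensorProduct.lift
    (LinearMap.mk₂ F
      (fun w v => ⟨(w : ExteriorAlgebra F (Sym' F c)) * ExteriorAlgebra.ι F v, by
        have h := Submodule.mul_mem_mul w.2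
          (LinearMap.mem_range_self (ExteriorAlgebra.ι F (M := Sym' F c)) v)
        rwa [← pow_succ] at h⟩)
      (fun w w' v => by ext; simp [add_mul])
      (fun a w v => by ext; simp [mul_assoc, Algebra.smul_mul_assoc])
      (fun w v v' => by ext; simp [mul_add])
      (fun a w v => by ext; simp [Algebra.mul_smul_comm]))

/-- The box `B(k) = [k₁,k₂) × ⋯ × [k_N, k_{N+1})` as a finset of multi-indices. -/
def box {N : ℕ} (k : Fin (N + 1) → ℕ) : Finset (Fin N → ℕ) :=
  Fintype.piFinset fun a : Fin N => Finset.Ico (k a.castSucc) (k a.succ)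

/-- `v_{(s,k)} = Σ_{i ∈ B(k)} F(i, s + |k| - N - |i|)`. -/
def vv (d N : ℕ) (s : ℕ) (k : Fin (N + 1) → ℕ) :
    (⋀[F]^N (Sym' F d)) ⊗[F] (Sym' F d) :=
  ∑ i ∈ box k, Fp F d i (s + (∑ a, k a) - N - ∑ a, i a)

/-- A pair `(i, j)` is semistandard (with entries in `{0,…,d}`). -/
def IsSS (d : ℕ) {N : ℕ} (p : (Fin N → ℕ) × ℕ) : Prop :=
  StrictMono p.1 ∧ (∀ a, p.1 a ≤ d) ∧ p.2 ≤ d ∧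
    ∀ a : Fin N, (a : ℕ) = 0 → p.1 a ≤ p.2

/-- The neighbour map `P`. -/
def Pmap {N : ℕ} (p : (Fin N → ℕ) × ℕ) : (Fin N → ℕ) × ℕ :=
  if h : (Finset.univ.filter fun a : Fin N => p.1 a ≤ p.2).Nonempty then
    let α := (Finset.univ.filter fun a : Fin N => p.1 a ≤ p.2).max' h
    (Function.update p.1 α p.2, p.1 α)
  else p

/-- `F_Δ(i,j)`. -/
def FDelta (d : ℕ) {N : ℕ} (p : (Fin N → ℕ) × ℕ) :
    (⋀[F]^N (Sym' F d)) ⊗[F] (Sym' F d) :=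
  if ∃ a, p.1 a = p.2 then Fp F d p.1 p.2
  else Fp F d p.1 p.2 + Fp F d (Pmap p).1 (Pmap p).2

/-- The content multiset of a pair. -/
def ssContent {N : ℕ} (p : (Fin N → ℕ) × ℕ) : Multiset ℕ :=
  p.2 ::ₘ Finset.univ.val.map p.1

abbrev Dom (N d : ℕ) : Type _ := (Sym' F (N - 1)) ⊗[F] ↥(⋀[F]^(N + 1) (Sym' F (d + 1)))

/-- The codomain `⋀^N Sym^d E ⊗ Sym^d E` of `φ`. -/
abbrev Cod (N d : ℕ) : Type _ := ↥(⋀[F]^N (Sym' F d)) ⊗[F] (Sym' F d)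

open Classical in
/-- indicator -/
def ind (p : Prop) : ℂ := if p then 1 else 0

lemma ind_true {p : Prop} (h : p) : ind p = 1 := by simp [ind, h]
lemma ind_false {p : Prop} (h : ¬ p) : ind p = 0 := by simp [ind, h]

lemma mem_box {N : ℕ} (k : Fin (N + 1) → ℕ) (i : Fin N → ℕ) :
    i ∈ box k ↔ ∀ b : Fin N, k b.castSucc ≤ i b ∧ i b < k b.succ := by
  simp [box, Fintype.mem_piFinset]

/-- the box condition away from coordinate `a`. -/
def off {N : ℕ} (k : Fin (N + 1) → ℕ) (i : Fin N → ℕ) (a : Fin N) : Prop :=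
  ∀ b : Fin N, b ≠ a → k b.castSucc ≤ i b ∧ i b < k b.succ

lemma sum_ind_succ {N : ℕ} (u : Fin (N + 1) → ℂ) (p : Fin N → Prop) :
    ∑ α, u α * ind (∃ a : Fin N, a.succ = α ∧ p a) = ∑ a, u a.succ * ind (p a) := by
  rw [Fin.sum_univ_succ]
  rw [ind_false (by rintro ⟨a, h, -⟩; exact Fin.succ_ne_zero _ h)]
  simp

lemma sum_ind_castSucc {N : ℕ} (u : Fin (N + 1) → ℂ) (p : Fin N → Prop) :
    ∑ α, u α * ind (∃ a : Fin N, a.castSucc = α ∧ p a) = ∑ a, u a.castSucc * ind (p a) := by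
  rw [Fin.sum_univ_castSucc]
  rw [ind_false (by rintro ⟨a, h, -⟩; exact Fin.castSucc_ne_last _ h)]
  simp

lemma box_e {N : ℕ} (k : Fin (N + 1) → ℕ) (hk : StrictMono k) (i : Fin N → ℕ)
    (hi : Function.Injective i) (α : Fin (N + 1)) (hα : 0 < k α) :
    ind (i ∈ box (Function.update k α (k α - 1))) =
      ind (i ∈ box k) - ind (∃ a : Fin N, a.succ = α ∧ (i a + 1 = k a.succ ∧ off k i a))
        + ind (∃ a : Fin N, a.castSucc = α ∧ (i a + 1 = k a.castSucc ∧ off k i a)) := by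
  have hlt : ∀ b : Fin N, k b.castSucc < k b.succ := fun b => hk b.castSucc_lt_succ
  have hne : ∀ b : Fin N, b.castSucc ≠ b.succ := fun b => b.castSucc_lt_succ.ne
  simp only [mem_box]
  by_cases hP : ∀ b : Fin N, k b.castSucc ≤ i b ∧ i b < k b.succ
  · rw [ind_true hP]
    rw [ind_false (p := ∃ a : Fin N, a.castSucc = α ∧ _)
      (by rintro ⟨a, -, h, -⟩; have := (hP a).1; omega)]
    by_cases hR : ∃ a : Fin N, a.succ = α ∧ (i a + 1 = k a.succ ∧ off k i a)
    · rw [ind_true hR, ind_false]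
      · simp
      obtain ⟨a, rfl, h, -⟩ := hR
      intro hh
      have := (hh a).2
      rw [Function.update_self] at this
      omega
    · rw [ind_false hR, ind_true]
      · simp
      intro b
      have h1 := hP b
      constructor
      · by_cases hb : b.castSucc = α
        · subst hb; rw [Function.update_self]; omega
        · rw [Function.update_of_ne hb]; omega
      · by_cases hb : b.succ = α
        · subst hb; rw [Function.update_self]
          have : i b + 1 ≠ k b.succ := fun h => hR ⟨b, rfl, h, fun c _ => hP c⟩
          omega
        · rw [Function.update_of_ne hb]; omega
  · rw [ind_false hP]
    rw [ind_false (p := ∃ a : Fin N, a.succ = α ∧ _)]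
    swap
    · rintro ⟨a, -, h, ho⟩
      apply hP
      intro b
      by_cases hb : b = a
      · subst hb; have := hlt b; omega
      · exact ho b hb
    by_cases hL : ∃ a : Fin N, a.castSucc = α ∧ (i a + 1 = k a.castSucc ∧ off k i a)
    · rw [ind_true hL, ind_true]
      · simp
      obtain ⟨a, rfl, h, ho⟩ := hL
      intro b
      by_cases hb : b = a
      · subst hb
        rw [Function.update_self, Function.update_of_ne (hne b).symm]
        have := hlt b
        omega
      · have h1 := ho b hb
        rw [Function.update_of_ne (by simpa using hb)]
        refine ⟨h1.1, ?_⟩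
        by_cases hc : b.succ = a.castSucc
        · have h2 : i b ≠ i a := fun h => hb (hi h)
          rw [hc] at h1 ⊢
          rw [Function.update_self]; omega
        · rw [Function.update_of_ne hc]; omega
    · rw [ind_false hL, ind_false]
      · simp
      intro hh
      push Not at hP
      have key : ∀ b : Fin N, i b < k b.succ := by
        intro b
        have := (hh b).2
        by_cases hc : b.succ = α
        · subst hc; rw [Function.update_self] at this; omega
        · rwa [Function.update_of_ne hc] at this
      obtain ⟨b, hb⟩ := hP
      have hb' : i b < k b.castSucc := by
        by_contra hcon
        have := hb (not_lt.1 hcon); have := key b; omega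
      have h1 := (hh b).1
      by_cases hc : b.castSucc = α
      · subst hc
        rw [Function.update_self] at h1
        refine hL ⟨b, rfl, by omega, fun c hcb => ⟨?_, key c⟩⟩
        have := (hh c).1
        rwa [Function.update_of_ne (by simpa using hcb)] at this
      · rw [Function.update_of_ne hc] at h1; omega

lemma box_f {N : ℕ} (k : Fin (N + 1) → ℕ) (hk : StrictMono k) (i : Fin N → ℕ)
    (hi : Function.Injective i) (α : Fin (N + 1)) :
    ind (i ∈ box (Function.update k α (k α + 1))) =
      ind (i ∈ box k) + ind (∃ a : Fin N, a.succ = α ∧ (i a = k a.succ ∧ off k i a))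
        - ind (∃ a : Fin N, a.castSucc = α ∧ (i a = k a.castSucc ∧ off k i a)) := by
  have hlt : ∀ b : Fin N, k b.castSucc < k b.succ := fun b => hk b.castSucc_lt_succ
  have hne : ∀ b : Fin N, b.castSucc ≠ b.succ := fun b => b.castSucc_lt_succ.ne
  simp only [mem_box]
  by_cases hP : ∀ b : Fin N, k b.castSucc ≤ i b ∧ i b < k b.succ
  · rw [ind_true hP]
    rw [ind_false (p := ∃ a : Fin N, a.succ = α ∧ _)
      (by rintro ⟨a, -, h, -⟩; have := (hP a).2; omega)]
    by_cases hR : ∃ a : Fin N, a.castSucc = α ∧ (i a = k a.castSucc ∧ off k i a)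
    · rw [ind_true hR, ind_false]
      · simp
      obtain ⟨a, rfl, h, -⟩ := hR
      intro hh
      have := (hh a).1
      rw [Function.update_self] at this
      omega
    · rw [ind_false hR, ind_true]
      · simp
      intro b
      have h1 := hP b
      constructor
      · by_cases hb : b.castSucc = α
        · subst hb; rw [Function.update_self]
          have : i b ≠ k b.castSucc := fun h => hR ⟨b, rfl, h, fun c _ => hP c⟩
          omega
        · rw [Function.update_of_ne hb]; omega
      · by_cases hb : b.succ = α
        · subst hb; rw [Function.update_self]; omega
        · rw [Function.update_of_ne hb]; omega
  · rw [ind_false hP]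
    rw [ind_false (p := ∃ a : Fin N, a.castSucc = α ∧ _)]
    swap
    · rintro ⟨a, -, h, ho⟩
      apply hP
      intro b
      by_cases hb : b = a
      · subst hb; have := hlt b; omega
      · exact ho b hb
    by_cases hL : ∃ a : Fin N, a.succ = α ∧ (i a = k a.succ ∧ off k i a)
    · rw [ind_true hL, ind_true]
      · simp
      obtain ⟨a, rfl, h, ho⟩ := hL
      intro b
      by_cases hb : b = a
      · subst hb
        rw [Function.update_self, Function.update_of_ne (hne b)]
        have := hlt b
        omega
      · have h1 := ho b hb
        rw [Function.update_of_ne (a := b.succ) (by simpa using hb)]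
        refine ⟨?_, h1.2⟩
        by_cases hc : b.castSucc = a.succ
        · have h2 : i b ≠ i a := fun h => hb (hi h)
          rw [hc] at h1 ⊢
          rw [Function.update_self]; omega
        · rw [Function.update_of_ne hc]; omega
    · rw [ind_false hL, ind_false]
      · simp
      intro hh
      push Not at hP
      have key : ∀ b : Fin N, k b.castSucc ≤ i b := by
        intro b
        have := (hh b).1
        by_cases hc : b.castSucc = α
        · subst hc; rw [Function.update_self] at this; omega
        · rwa [Function.update_of_ne hc] at this
      obtain ⟨b, hb⟩ := hP
      have hb' := hb (key b)
      have h1 := (hh b).2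
      by_cases hc : b.succ = α
      · subst hc
        rw [Function.update_self] at h1
        refine hL ⟨b, rfl, by omega, fun c hcb => ⟨key c, ?_⟩⟩
        have := (hh c).2
        rwa [Function.update_of_ne (by simpa using hcb)] at this
      · rw [Function.update_of_ne hc] at h1; omega

/-- moving one coordinate, condition split -/
lemma box_upd {N : ℕ} (k : Fin (N + 1) → ℕ) (i : Fin N → ℕ) (a : Fin N) (x : ℕ) :
    Function.update i a x ∈ box k ↔ (k a.castSucc ≤ x ∧ x < k a.succ) ∧ off k i a := by
  rw [mem_box]
  constructor
  · intro h
    refine ⟨by simpa using h a, fun b hb => ?_⟩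
    simpa [Function.update_of_ne hb] using h b
  · rintro ⟨h1, h2⟩ b
    by_cases hb : b = a
    · subst hb; simpa using h1
    · simpa [Function.update_of_ne hb] using h2 b hb

lemma coef_e {N : ℕ} (k : Fin (N + 1) → ℕ) (hk : StrictMono k) (i : Fin N → ℕ) (a : Fin N) :
    ((i a : ℂ) + 1) * ind (Function.update i a (i a + 1) ∈ box k) =
      ((i a : ℂ) + 1) * ind (i ∈ box k)
      + (k a.castSucc : ℂ) * ind (i a + 1 = k a.castSucc ∧ off k i a)
      - (k a.succ : ℂ) * ind (i a + 1 = k a.succ ∧ off k i a) := by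
  have hlt : k a.castSucc < k a.succ := hk a.castSucc_lt_succ
  have h0 := box_upd k i a (i a)
  rw [Function.update_eq_self] at h0
  rw [box_upd, h0]
  clear h0
  by_cases ho : off k i a
  swap
  · simp [ho, ind]
  simp only [ho, and_true]
  clear ho hk
  generalize k a.castSucc = p at *
  generalize k a.succ = q at *
  generalize i a = x at *
  by_cases h1 : x + 1 = p
  · subst h1
    rw [ind_true (p := _ ≤ _ ∧ _) (by omega), ind_false (p := _ ≤ _ ∧ _) (by omega),
      ind_true rfl, ind_false (by omega)]
    push_cast; ring
  by_cases h2 : x + 1 = q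
  · subst h2
    rw [ind_false (p := _ ∧ x + 1 < _) (by omega), ind_true (p := _ ≤ _ ∧ _) (by omega),
      ind_false h1, ind_true rfl]
    push_cast; ring
  have : (p ≤ x + 1 ∧ x + 1 < q) ↔ (p ≤ x ∧ x < q) := by
    omega
  rw [this, ind_false h1, ind_false h2]
  ring

lemma coef_f {N : ℕ} (D : ℂ) (k : Fin (N + 1) → ℕ) (hk : StrictMono k) (i : Fin N → ℕ)
    (a : Fin N) :
    (D - (i a : ℂ)) * ind (0 < i a ∧ Function.update i a (i a - 1) ∈ box k) =
      (D - (i a : ℂ)) * ind (i ∈ box k)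
      - (D - (k a.castSucc : ℂ)) * ind (i a = k a.castSucc ∧ off k i a)
      + (D - (k a.succ : ℂ)) * ind (i a = k a.succ ∧ off k i a) := by
  have hlt : k a.castSucc < k a.succ := hk a.castSucc_lt_succ
  have h0 := box_upd k i a (i a)
  rw [Function.update_eq_self] at h0
  rw [box_upd, h0]
  clear h0
  by_cases ho : off k i a
  swap
  · simp [ho, ind]
  simp only [ho, and_true]
  clear ho hk
  generalize k a.castSucc = p at *
  generalize k a.succ = q at *
  generalize i a = x at *
  by_cases h1 : x = p
  · subst h1
    rw [ind_false (p := 0 < _ ∧ _) (by omega), ind_true (p := _ ≤ _ ∧ _) (by omega),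
      ind_true rfl, ind_false (by omega)]
    ring
  by_cases h2 : x = q
  · subst h2
    rw [ind_true (p := 0 < _ ∧ _) (by omega), ind_false (p := _ ≤ _ ∧ _) (by omega),
      ind_false h1, ind_true rfl]
    ring
  have : (0 < x ∧ p ≤ x - 1 ∧ x - 1 < q) ↔ (p ≤ x ∧ x < q) := by
    omega
  rw [this, ind_false h1, ind_false h2]
  ring

lemma sum_box_eq {N : ℕ} {M : Type*} [AddCommGroup M] [Module ℂ M] (T S : Finset (Fin N → ℕ))
    (hS : S ⊆ T) (G : (Fin N → ℕ) → M) :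
    ∑ i ∈ S, G i = ∑ i ∈ T, ind (i ∈ S) • G i := by
  classical
  rw [← Finset.sum_subset hS]
  · refine Finset.sum_congr rfl fun i hi => ?_
    rw [ind_true hi, one_smul]
  · intro i _ hi
    rw [ind_false hi, zero_smul]

lemma box_sub {N : ℕ} (D : ℕ) (k : Fin (N + 1) → ℕ) (hD : ∀ a, k a ≤ D) :
    box k ⊆ Fintype.piFinset fun _ : Fin N => Finset.range D := by
  intro i hi
  rw [mem_box] at hi
  simp only [Fintype.mem_piFinset, Finset.mem_range]
  intro a
  have := hi a; have := hD a.succ; omega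

lemma shift_e {N : ℕ} {M : Type*} [AddCommGroup M] [Module ℂ M] (D : ℕ)
    (k : Fin (N + 1) → ℕ) (hD : ∀ a, k a ≤ D) (G : (Fin N → ℕ) → M) (α : Fin N) :
    ∑ i ∈ box k, (i α : ℂ) • G (Function.update i α (i α - 1)) =
      ∑ i ∈ Fintype.piFinset fun _ : Fin N => Finset.range D,
        (((i α : ℂ) + 1) * ind (Function.update i α (i α + 1) ∈ box k)) • G i := by
  classical
  rw [← Finset.sum_filter_of_ne (p := fun i => 0 < i α)]
  swap
  · intro i _ h
    by_contra h0
    simp [show i α = 0 by omega] at h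
  rw [← Finset.sum_filter_of_ne (s := Fintype.piFinset _)
    (p := fun i => Function.update i α (i α + 1) ∈ box k)]
  swap
  · intro i _ h
    by_contra h0
    simp [ind_false h0] at h
  refine Finset.sum_nbij' (fun i => Function.update i α (i α - 1))
    (fun i => Function.update i α (i α + 1)) ?_ ?_ ?_ ?_ ?_
  · intro i hi
    rw [Finset.mem_filter] at hi ⊢
    obtain ⟨h1, h2⟩ := hi
    have h3 := box_sub D k hD h1
    simp only [Fintype.mem_piFinset, Finset.mem_range] at h3 ⊢
    constructor
    · intro b
      by_cases hb : b = α
      · subst hb; have := h3 b; simp; omega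
      · simpa [hb] using h3 b
    · simpa [show i α - 1 + 1 = i α by omega] using h1
  · intro i hi
    rw [Finset.mem_filter] at hi ⊢
    exact ⟨hi.2, by simp⟩
  · intro i hi
    rw [Finset.mem_filter] at hi
    simp [show i α - 1 + 1 = i α by omega]
  · intro i hi
    simp
  · intro i hi
    rw [Finset.mem_filter] at hi
    have h : i α - 1 + 1 = i α := by omega
    simp only [Function.update_self, Function.update_idem, h, Function.update_eq_self]
    rw [ind_true hi.1, mul_one]
    congr 1
    rw [← h]; push_cast; simp

lemma shift_f {N : ℕ} {M : Type*} [AddCommGroup M] [Module ℂ M] (d : ℕ)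
    (k : Fin (N + 1) → ℕ) (hD : ∀ a, k a ≤ d + 1) (G : (Fin N → ℕ) → M) (α : Fin N) :
    ∑ i ∈ box k, ((d : ℂ) - (i α : ℂ)) • G (Function.update i α (i α + 1)) =
      ∑ i ∈ Fintype.piFinset fun _ : Fin N => Finset.range (d + 2),
        ((((d : ℂ) + 1) - (i α : ℂ)) *
          ind (0 < i α ∧ Function.update i α (i α - 1) ∈ box k)) • G i := by
  classical
  rw [← Finset.sum_filter_of_ne (s := Fintype.piFinset _)
    (p := fun i => 0 < i α ∧ Function.update i α (i α - 1) ∈ box k)]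
  swap
  · intro i _ h
    by_contra h0
    simp [ind_false h0] at h
  refine Finset.sum_nbij' (fun i => Function.update i α (i α + 1))
    (fun i => Function.update i α (i α - 1)) ?_ ?_ ?_ ?_ ?_
  · intro i h1
    rw [Finset.mem_filter]
    have h3 := box_sub (d + 1) k hD h1
    simp only [Fintype.mem_piFinset, Finset.mem_range] at h3 ⊢
    constructor
    · intro b
      have := h3 b
      by_cases hb : b = α
      · subst hb; simp; omega
      · simp [hb]; omega
    · simpa using h1
  · intro i hi
    rw [Finset.mem_filter] at hi
    exact hi.2.2
  · intro i hi
    simp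
  · intro i hi
    rw [Finset.mem_filter] at hi
    simp [show i α - 1 + 1 = i α by omega]
  · intro i hi
    simp only [Function.update_self, Function.update_idem, Nat.add_sub_cancel,
      Function.update_eq_self]
    rw [ind_true ⟨by omega, hi⟩, mul_one]
    congr 1
    push_cast; ring

lemma comb_e {N : ℕ} {M : Type*} [AddCommGroup M] [Module ℂ M] (D : ℕ)
    (k : Fin (N + 1) → ℕ) (hk : StrictMono k) (hD : ∀ a, k a ≤ D) (G : (Fin N → ℕ) → M)
    (hG : ∀ i, ¬ Function.Injective i → G i = 0) :
    ∑ α, (k α : ℂ) • ∑ i ∈ box (Function.update k α (k α - 1)), G i =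
      ∑ i ∈ box k, (∑ α, (i α : ℂ) • G (Function.update i α (i α - 1))
        + ((∑ α, (k α : ℂ)) - N - ∑ α, (i α : ℂ)) • G i) := by
  rw [Finset.sum_add_distrib, Finset.sum_comm, Finset.sum_congr rfl fun α _ =>
    shift_e D k hD G α]
  rw [sum_box_eq _ _ (box_sub D k hD)]
  have h1 : ∀ α, box (Function.update k α (k α - 1)) ⊆
      Fintype.piFinset fun _ : Fin N => Finset.range D := by
    intro α
    apply box_sub
    intro a
    by_cases h : a = α
    · subst h; have := hD a; simp; omega
    · simpa [h] using hD a
  rw [Finset.sum_congr rfl fun α _ => by rw [sum_box_eq _ _ (h1 α), Finset.smul_sum]]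
  rw [Finset.sum_comm, Finset.sum_comm (s := Finset.univ), ← Finset.sum_add_distrib]
  refine Finset.sum_congr rfl fun i _ => ?_
  by_cases hi : Function.Injective i
  swap
  · simp [hG i hi]
  simp only [smul_smul, ← Finset.sum_smul, ← add_smul]
  congr 1
  have h2 : ∀ α, (k α : ℂ) * ind (i ∈ box (Function.update k α (k α - 1))) =
      (k α : ℂ) * ind (i ∈ box k)
      - (k α : ℂ) * ind (∃ a : Fin N, a.succ = α ∧ (i a + 1 = k a.succ ∧ off k i a))
      + (k α : ℂ) * ind (∃ a : Fin N, a.castSucc = α ∧ (i a + 1 = k a.castSucc ∧ off k i a)) := by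
    intro α
    rcases Nat.eq_zero_or_pos (k α) with h | h
    · simp [h]
    · rw [box_e k hk i hi α h]; ring
  rw [Finset.sum_congr rfl fun α _ => h2 α, Finset.sum_congr rfl fun α _ => coef_e k hk i α]
  rw [Finset.sum_add_distrib, Finset.sum_sub_distrib, Finset.sum_sub_distrib,
    Finset.sum_add_distrib, sum_ind_succ (fun α => (k α : ℂ)),
    sum_ind_castSucc (fun α => (k α : ℂ)), ← Finset.sum_mul, ← Finset.sum_mul,
    Finset.sum_add_distrib]
  simp
  ring

lemma comb_f {N : ℕ} {M : Type*} [AddCommGroup M] [Module ℂ M] (d : ℕ)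
    (k : Fin (N + 1) → ℕ) (hk : StrictMono k) (hD : ∀ a, k a ≤ d + 1) (G : (Fin N → ℕ) → M)
    (hG : ∀ i, ¬ Function.Injective i → G i = 0) :
    ∑ α, ((d : ℂ) + 1 - (k α : ℂ)) • ∑ i ∈ box (Function.update k α (k α + 1)), G i =
      ∑ i ∈ box k, (∑ α, ((d : ℂ) - (i α : ℂ)) • G (Function.update i α (i α + 1))
        + ((d : ℂ) + 1 - (∑ α, (k α : ℂ)) + ∑ α, (i α : ℂ)) • G i) := by
  rw [Finset.sum_add_distrib, Finset.sum_comm, Finset.sum_congr rfl fun α _ =>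
    shift_f d k hD G α]
  rw [sum_box_eq _ _ (box_sub (d + 2) k fun a => by have := hD a; omega)]
  have h1 : ∀ α, box (Function.update k α (k α + 1)) ⊆
      Fintype.piFinset fun _ : Fin N => Finset.range (d + 2) := by
    intro α
    apply box_sub
    intro a
    have := hD a
    by_cases h : a = α
    · subst h; simp; omega
    · simp [h]; omega
  rw [Finset.sum_congr rfl fun α _ => by rw [sum_box_eq _ _ (h1 α), Finset.smul_sum]]
  rw [Finset.sum_comm, Finset.sum_comm (s := Finset.univ), ← Finset.sum_add_distrib]
  refine Finset.sum_congr rfl fun i _ => ?_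
  by_cases hi : Function.Injective i
  swap
  · simp [hG i hi]
  simp only [smul_smul, ← Finset.sum_smul, ← add_smul]
  congr 1
  have h2 : ∀ α, ((d : ℂ) + 1 - (k α : ℂ)) * ind (i ∈ box (Function.update k α (k α + 1))) =
      ((d : ℂ) + 1 - (k α : ℂ)) * ind (i ∈ box k)
      + ((d : ℂ) + 1 - (k α : ℂ)) *
        ind (∃ a : Fin N, a.succ = α ∧ (i a = k a.succ ∧ off k i a))
      - ((d : ℂ) + 1 - (k α : ℂ)) *
        ind (∃ a : Fin N, a.castSucc = α ∧ (i a = k a.castSucc ∧ off k i a)) := by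
    intro α
    rw [box_f k hk i hi α]; ring
  rw [Finset.sum_congr rfl fun α _ => h2 α,
    Finset.sum_congr rfl fun α _ => coef_f ((d : ℂ) + 1) k hk i α]
  rw [Finset.sum_sub_distrib, Finset.sum_add_distrib, Finset.sum_add_distrib,
    Finset.sum_sub_distrib, sum_ind_succ (fun α => (d : ℂ) + 1 - (k α : ℂ)),
    sum_ind_castSucc (fun α => (d : ℂ) + 1 - (k α : ℂ)), ← Finset.sum_mul, ← Finset.sum_mul,
    Finset.sum_sub_distrib, Finset.sum_sub_distrib]
  simp
  ring

lemma XY_span (c : ℕ) :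
    Submodule.span ℂ (Set.range fun s : Fin (c + 1) => XY ℂ c s) = ⊤ := by
  rw [eq_top_iff]
  rintro ⟨p, hp⟩ -
  have hp' : p.IsHomogeneous c := hp
  have key : p ∈ Submodule.map (Submodule.subtype _)
      (Submodule.span ℂ (Set.range fun s : Fin (c + 1) => XY ℂ c s)) := by
    rw [p.as_sum]
    refine Submodule.sum_mem _ fun m hm => ?_
    have h1 : m 0 + m 1 = c := by
      have := hp' (MvPolynomial.mem_support_iff.1 hm)
      rw [← this]
      simp [Finsupp.weight_apply, Finsupp.sum_fintype, Fin.sum_univ_two]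
    refine ⟨MvPolynomial.coeff m p • XY ℂ c (m 1), Submodule.smul_mem _ _
      (Submodule.subset_span ⟨⟨m 1, by omega⟩, rfl⟩), ?_⟩
    have h2 : m 1 ≤ c := by omega
    have h3 : c - m 1 = m 0 := by omega
    simp only [XY, dif_pos h2, h3, map_smul, Submodule.subtype_apply]
    rw [MvPolynomial.monomial_eq, Finsupp.prod_fintype _ _ (by simp), Fin.prod_univ_two,
      MvPolynomial.smul_eq_C_mul]
  obtain ⟨q, hq, h⟩ := key
  have : q = ⟨p, hp⟩ := Subtype.ext h
  rwa [this] at hq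

lemma wedge_span (c r : ℕ) :
    Submodule.span ℂ {w | ∃ k : Fin r → ℕ, StrictMono k ∧ (∀ a, k a ≤ c) ∧ w = wedge ℂ c k}
      = ⊤ := by
  rw [eq_top_iff, ← exteriorPower.ιMulti_family_span_of_span ℂ (n := r) (XY_span c)]
  apply Submodule.span_mono
  rintro _ ⟨s, rfl⟩
  refine ⟨fun a => (Set.powersetCard.ofFinEmbEquiv.symm s a : Fin (c + 1)), ?_, ?_, ?_⟩
  · intro a b hab
    exact (Set.powersetCard.ofFinEmbEquiv.symm s).strictMono hab
  · intro a
    exact Nat.lt_succ_iff.1 (Fin.is_lt _)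
  · rfl

lemma wedge_zero (c : ℕ) {r : ℕ} (k : Fin r → ℕ) (hk : ¬ Function.Injective k) :
    wedge ℂ c k = 0 := by
  apply Subtype.ext
  rw [Function.not_injective_iff] at hk
  obtain ⟨a, b, h, hab⟩ := hk
  exact AlternatingMap.map_eq_zero_of_eq _ _ (by simp [h]) hab

lemma box_sum_le {N : ℕ} (k : Fin (N + 1) → ℕ) (i : Fin N → ℕ) (hi : i ∈ box k) :
    (∑ a, i a) + N ≤ ∑ a, k a := by
  rw [mem_box] at hi
  rw [Fin.sum_univ_succ]
  have : ∑ a, (i a + 1) ≤ ∑ a : Fin N, k a.succ :=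
    Finset.sum_le_sum fun a _ => (hi a).2
  rw [Finset.sum_add_distrib] at this
  simp at this
  omega

lemma box_sum_ge {N : ℕ} (k : Fin (N + 1) → ℕ) (i : Fin N → ℕ) (hi : i ∈ box k) :
    ∑ a, k a ≤ (∑ a, i a) + k (Fin.last N) := by
  rw [mem_box] at hi
  rw [Fin.sum_univ_castSucc]
  have : ∑ a : Fin N, k a.castSucc ≤ ∑ a, i a :=
    Finset.sum_le_sum fun a _ => (hi a).1
  omega

lemma sum_update {n : ℕ} (k : Fin n → ℕ) (α : Fin n) (x : ℕ) :
    (∑ a, Function.update k α x a) + k α = (∑ a, k a) + x := by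
  rw [Finset.sum_update_of_mem (Finset.mem_univ _), ← Finset.erase_eq,
    ← Finset.add_sum_erase _ k (Finset.mem_univ α)]
  omega

lemma phi_mono (N d : ℕ) (φ : Dom ℂ N d →ₗ[ℂ] Cod ℂ N d)
    (hφ : ∀ s < N, ∀ k : Fin (N + 1) → ℕ, StrictMono k → (∀ a, k a ≤ d + 1) →
      φ (XY ℂ (N - 1) s ⊗ₜ[ℂ] wedge ℂ (d + 1) k) = vv ℂ d N s k)
    (s : ℕ) (hs : s < N) (k : Fin (N + 1) → ℕ) (hk : Monotone k) (hd : ∀ a, k a ≤ d + 1) :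
    φ (XY ℂ (N - 1) s ⊗ₜ[ℂ] wedge ℂ (d + 1) k) = vv ℂ d N s k := by
  by_cases h : StrictMono k
  · exact hφ s hs k h hd
  rw [Fin.strictMono_iff_lt_succ] at h
  push Not at h
  obtain ⟨b, hb⟩ := h
  have hbox : box k = ∅ := by
    rw [Finset.eq_empty_iff_forall_notMem]
    intro i hi
    rw [mem_box] at hi
    have := hi b; omega
  rw [wedge_zero, vv, hbox]
  · simp
  · intro hinj
    exact b.castSucc_lt_succ.ne (hinj (le_antisymm (hk b.castSucc_lt_succ.le) hb))

lemma mono_e {n : ℕ} (k : Fin n → ℕ) (hk : StrictMono k) (α : Fin n) :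
    Monotone (Function.update k α (k α - 1)) := by
  intro a b hab
  rcases hab.eq_or_lt with rfl | hab
  · rfl
  have := hk hab
  by_cases ha : a = α
  · subst ha
    rw [Function.update_self, Function.update_of_ne hab.ne']; omega
  · rw [Function.update_of_ne ha]
    by_cases hb : b = α
    · subst hb; rw [Function.update_self]; omega
    · rw [Function.update_of_ne hb]; omega

lemma mono_f {n : ℕ} (k : Fin n → ℕ) (hk : StrictMono k) (α : Fin n) :
    Monotone (Function.update k α (k α + 1)) := by
  intro a b hab
  rcases hab.eq_or_lt with rfl | hab
  · rfl
  have := hk hab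
  by_cases ha : a = α
  · subst ha
    rw [Function.update_self, Function.update_of_ne hab.ne']; omega
  · rw [Function.update_of_ne ha]
    by_cases hb : b = α
    · subst hb; rw [Function.update_self]; omega
    · rw [Function.update_of_ne hb]; omega

lemma dom_ext (N d : ℕ) {M : Type*} [AddCommMonoid M] [Module ℂ M]
    (A B : Dom ℂ N d →ₗ[ℂ] M) (hN : 0 < N)
    (h : ∀ s < N, ∀ k : Fin (N + 1) → ℕ, StrictMono k → (∀ a, k a ≤ d + 1) →
      A (XY ℂ (N - 1) s ⊗ₜ[ℂ] wedge ℂ (d + 1) k) = B (XY ℂ (N - 1) s ⊗ₜ[ℂ] wedge ℂ (d + 1) k)) :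
    A = B := by
  apply TensorProduct.ext
  apply LinearMap.ext_on_range (XY_span (N - 1))
  intro s
  apply LinearMap.ext_on (wedge_span (d + 1) (N + 1))
  rintro _ ⟨k, hk, hd, rfl⟩
  exact h s (by have := s.2; omega) k hk hd

lemma main_e (N d : ℕ) (hN : 0 < N)
    (eS : Sym' ℂ (N - 1) →ₗ[ℂ] Sym' ℂ (N - 1))
    (heS : ∀ s ≤ N - 1, eS (XY ℂ (N - 1) s) = (s : ℂ) • XY ℂ (N - 1) (s - 1))
    (eW : ↥(⋀[ℂ]^(N + 1) (Sym' ℂ (d + 1))) →ₗ[ℂ] ↥(⋀[ℂ]^(N + 1) (Sym' ℂ (d + 1))))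
    (heW : ∀ k : Fin (N + 1) → ℕ, (∀ a, k a ≤ d + 1) →
      eW (wedge ℂ (d + 1) k) =
        ∑ α, (k α : ℂ) • wedge ℂ (d + 1) (Function.update k α (k α - 1)))
    (eV : ↥(⋀[ℂ]^N (Sym' ℂ d)) →ₗ[ℂ] ↥(⋀[ℂ]^N (Sym' ℂ d)))
    (heV : ∀ k : Fin N → ℕ, (∀ a, k a ≤ d) →
      eV (wedge ℂ d k) = ∑ α, (k α : ℂ) • wedge ℂ d (Function.update k α (k α - 1)))
    (eSd : Sym' ℂ d →ₗ[ℂ] Sym' ℂ d)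
    (heSd : ∀ j ≤ d, eSd (XY ℂ d j) = (j : ℂ) • XY ℂ d (j - 1))
    (φ : Dom ℂ N d →ₗ[ℂ] Cod ℂ N d)
    (hφ : ∀ s < N, ∀ k : Fin (N + 1) → ℕ, StrictMono k → (∀ a, k a ≤ d + 1) →
      φ (XY ℂ (N - 1) s ⊗ₜ[ℂ] wedge ℂ (d + 1) k) = vv ℂ d N s k)
    (s : ℕ) (hs : s < N) (k : Fin (N + 1) → ℕ) (hk : StrictMono k) (hd : ∀ a, k a ≤ d + 1) :
    φ (eS (XY ℂ (N - 1) s) ⊗ₜ[ℂ] wedge ℂ (d + 1) k + XY ℂ (N - 1) s ⊗ₜ[ℂ] eW (wedge ℂ (d + 1) k))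
      = ((TensorProduct.map eV LinearMap.id + TensorProduct.map LinearMap.id eSd :
            Cod ℂ N d →ₗ[ℂ] Cod ℂ N d)) (vv ℂ d N s k) := by
  set G : (Fin N → ℕ) → Cod ℂ N d := fun i => Fp ℂ d i (s + (∑ a, k a) - 1 - N - ∑ a, i a)
    with hGdef
  have hG : ∀ i, ¬ Function.Injective i → G i = 0 := by
    intro i hi
    simp [hGdef, Fp, wedge_zero d i hi]
  have hcomb := comb_e (d + 1) k hk hd G hG
  rw [heS s (by omega), heW k hd, map_add, TensorProduct.tmul_sum, map_sum,
    ← TensorProduct.smul_tmul', map_smul]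
  have L1 : (s : ℂ) • φ (XY ℂ (N - 1) (s - 1) ⊗ₜ[ℂ] wedge ℂ (d + 1) k)
      = (s : ℂ) • ∑ i ∈ box k, G i := by
    rcases Nat.eq_zero_or_pos s with h | h
    · simp [h]
    · rw [hφ (s - 1) (by omega) k hk hd, vv]
      congr 1
      refine Finset.sum_congr rfl fun i _ => ?_
      simp only [hGdef]
      congr 1
      omega
  have L2 : ∀ α, φ (XY ℂ (N - 1) s ⊗ₜ[ℂ]
      ((k α : ℂ) • wedge ℂ (d + 1) (Function.update k α (k α - 1)))) =
      (k α : ℂ) • ∑ i ∈ box (Function.update k α (k α - 1)), G i := by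
    intro α
    rw [TensorProduct.tmul_smul, map_smul]
    rcases Nat.eq_zero_or_pos (k α) with h | h
    · simp [h]
    · rw [phi_mono N d φ hφ s hs _ (mono_e k hk α), vv]
      · congr 1
        refine Finset.sum_congr rfl fun i _ => ?_
        simp only [hGdef]
        congr 1
        have := sum_update k α (k α - 1)
        omega
      · intro a
        by_cases ha : a = α
        · subst ha; have := hd a; simp; omega
        · simpa [ha] using hd a
  rw [L1, Finset.sum_congr rfl fun α _ => L2 α, hcomb, vv, map_sum, Finset.smul_sum,
    ← Finset.sum_add_distrib]
  refine Finset.sum_congr rfl fun i hi => ?_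
  have b1 := box_sum_le k i hi
  have b2 := box_sum_ge k i hi
  have b3 := hd (Fin.last N)
  have hid : ∀ a, i a ≤ d := by
    intro a
    have := (mem_box k i).1 hi a
    have := hd a.succ
    omega
  rw [LinearMap.add_apply, Fp, TensorProduct.map_tmul, TensorProduct.map_tmul,
    heV i hid, heSd _ (by omega), TensorProduct.sum_tmul, TensorProduct.tmul_smul]
  simp only [LinearMap.id_apply, ← TensorProduct.smul_tmul']
  rw [add_left_comm, ← add_smul]
  congr 1
  · refine Finset.sum_congr rfl fun α _ => ?_
    rcases Nat.eq_zero_or_pos (i α) with h | h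
    · simp [h]
    · congr 1
      simp only [hGdef, Fp]
      congr 2
      have := sum_update i α (i α - 1)
      omega
  · congr 1
    · rw [Nat.sub_sub, Nat.cast_sub (by omega)]
      push_cast
      ring
    · simp only [hGdef, Fp]
      congr 2
      omega

lemma main_f (N d : ℕ) (hN : 0 < N)
    (fS : Sym' ℂ (N - 1) →ₗ[ℂ] Sym' ℂ (N - 1))
    (hfS : ∀ s ≤ N - 1, fS (XY ℂ (N - 1) s) = ((N - 1 - s : ℕ) : ℂ) • XY ℂ (N - 1) (s + 1))
    (fW : ↥(⋀[ℂ]^(N + 1) (Sym' ℂ (d + 1))) →ₗ[ℂ] ↥(⋀[ℂ]^(N + 1) (Sym' ℂ (d + 1))))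
    (hfW : ∀ k : Fin (N + 1) → ℕ, (∀ a, k a ≤ d + 1) →
      fW (wedge ℂ (d + 1) k) =
        ∑ α, ((d + 1 - k α : ℕ) : ℂ) • wedge ℂ (d + 1) (Function.update k α (k α + 1)))
    (fV : ↥(⋀[ℂ]^N (Sym' ℂ d)) →ₗ[ℂ] ↥(⋀[ℂ]^N (Sym' ℂ d)))
    (hfV : ∀ k : Fin N → ℕ, (∀ a, k a ≤ d) →
      fV (wedge ℂ d k) = ∑ α, ((d - k α : ℕ) : ℂ) • wedge ℂ d (Function.update k α (k α + 1)))
    (fSd : Sym' ℂ d →ₗ[ℂ] Sym' ℂ d)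
    (hfSd : ∀ j ≤ d, fSd (XY ℂ d j) = ((d - j : ℕ) : ℂ) • XY ℂ d (j + 1))
    (φ : Dom ℂ N d →ₗ[ℂ] Cod ℂ N d)
    (hφ : ∀ s < N, ∀ k : Fin (N + 1) → ℕ, StrictMono k → (∀ a, k a ≤ d + 1) →
      φ (XY ℂ (N - 1) s ⊗ₜ[ℂ] wedge ℂ (d + 1) k) = vv ℂ d N s k)
    (s : ℕ) (hs : s < N) (k : Fin (N + 1) → ℕ) (hk : StrictMono k) (hd : ∀ a, k a ≤ d + 1) :
    φ (fS (XY ℂ (N - 1) s) ⊗ₜ[ℂ] wedge ℂ (d + 1) k + XY ℂ (N - 1) s ⊗ₜ[ℂ] fW (wedge ℂ (d + 1) k))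
      = ((TensorProduct.map fV LinearMap.id + TensorProduct.map LinearMap.id fSd :
            Cod ℂ N d →ₗ[ℂ] Cod ℂ N d)) (vv ℂ d N s k) := by
  set G : (Fin N → ℕ) → Cod ℂ N d := fun i => Fp ℂ d i (s + (∑ a, k a) + 1 - N - ∑ a, i a)
    with hGdef
  have hG : ∀ i, ¬ Function.Injective i → G i = 0 := by
    intro i hi
    simp [hGdef, Fp, wedge_zero d i hi]
  have hcomb := comb_f d k hk hd G hG
  rw [hfS s (by omega), hfW k hd, map_add, TensorProduct.tmul_sum, map_sum,
    ← TensorProduct.smul_tmul', map_smul]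
  have L1 : ((N - 1 - s : ℕ) : ℂ) • φ (XY ℂ (N - 1) (s + 1) ⊗ₜ[ℂ] wedge ℂ (d + 1) k)
      = ((N - 1 - s : ℕ) : ℂ) • ∑ i ∈ box k, G i := by
    rcases Nat.eq_zero_or_pos (N - 1 - s) with h | h
    · simp [h]
    · rw [hφ (s + 1) (by omega) k hk hd, vv]
      congr 1
      refine Finset.sum_congr rfl fun i _ => ?_
      simp only [hGdef]
      congr 1
      omega
  have L2 : ∀ α, φ (XY ℂ (N - 1) s ⊗ₜ[ℂ]
      (((d + 1 - k α : ℕ) : ℂ) • wedge ℂ (d + 1) (Function.update k α (k α + 1)))) =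
      ((d : ℂ) + 1 - (k α : ℂ)) • ∑ i ∈ box (Function.update k α (k α + 1)), G i := by
    intro α
    rw [TensorProduct.tmul_smul, map_smul]
    have hc : ((d + 1 - k α : ℕ) : ℂ) = (d : ℂ) + 1 - (k α : ℂ) := by
      rw [Nat.cast_sub (hd α)]; push_cast; ring
    rw [← hc]
    rcases Nat.eq_zero_or_pos (d + 1 - k α) with h | h
    · simp only [h, Nat.cast_zero, zero_smul]
    · rw [phi_mono N d φ hφ s hs _ (mono_f k hk α), vv]
      · congr 1
        refine Finset.sum_congr rfl fun i _ => ?_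
        simp only [hGdef]
        congr 1
        have := sum_update k α (k α + 1)
        omega
      · intro a
        by_cases ha : a = α
        · subst ha; simp; omega
        · simpa [ha] using hd a
  rw [L1, Finset.sum_congr rfl fun α _ => L2 α, hcomb, vv, map_sum, Finset.smul_sum,
    ← Finset.sum_add_distrib]
  refine Finset.sum_congr rfl fun i hi => ?_
  have b1 := box_sum_le k i hi
  have b2 := box_sum_ge k i hi
  have b3 := hd (Fin.last N)
  have hid : ∀ a, i a ≤ d := by
    intro a
    have := (mem_box k i).1 hi a
    have := hd a.succ
    omega
  rw [LinearMap.add_apply, Fp, TensorProduct.map_tmul, TensorProduct.map_tmul,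
    hfV i hid, hfSd _ (by omega), TensorProduct.sum_tmul, TensorProduct.tmul_smul]
  simp only [LinearMap.id_apply, ← TensorProduct.smul_tmul']
  rw [add_left_comm, ← add_smul]
  congr 1
  · refine Finset.sum_congr rfl fun α _ => ?_
    rw [Nat.cast_sub (hid α)]
    congr 1
    simp only [hGdef, Fp]
    congr 2
    have := sum_update i α (i α + 1)
    omega
  · congr 1
    · rw [Nat.cast_sub (show s + ∑ a, k a - N - ∑ a, i a ≤ d by omega), Nat.sub_sub (s + ∑ a, k a),
        Nat.cast_sub (show N + ∑ a, i a ≤ s + ∑ a, k a by omega), Nat.sub_sub N,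
        Nat.cast_sub (show 1 + s ≤ N by omega)]
      push_cast
      ring
    · simp only [hGdef, Fp]
      congr 2
      omega

/-- Proposition 2.11 of the paper. Over `ℂ`, the map `φ` is a homomorphism of
`sl₂(ℂ)`-modules: it commutes with the actions of both Lie algebra generators `e` and `f`
(which act on `Sym^c E` by `X ∂/∂Y` and `Y ∂/∂X` respectively, and on tensor and exterior
products by the derivation rule). -/
theorem statement13 (N d : ℕ) (hN : 0 < N)
    (eS fS : Sym' ℂ (N - 1) →ₗ[ℂ] Sym' ℂ (N - 1))
    (heS : ∀ s ≤ N - 1, eS (XY ℂ (N - 1) s) = (s : ℂ) • XY ℂ (N - 1) (s - 1))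
    (hfS : ∀ s ≤ N - 1, fS (XY ℂ (N - 1) s) = ((N - 1 - s : ℕ) : ℂ) • XY ℂ (N - 1) (s + 1))
    (eW fW : ↥(⋀[ℂ]^(N + 1) (Sym' ℂ (d + 1))) →ₗ[ℂ] ↥(⋀[ℂ]^(N + 1) (Sym' ℂ (d + 1))))
    (heW : ∀ k : Fin (N + 1) → ℕ, (∀ a, k a ≤ d + 1) →
      eW (wedge ℂ (d + 1) k) =
        ∑ α, (k α : ℂ) • wedge ℂ (d + 1) (Function.update k α (k α - 1)))
    (hfW : ∀ k : Fin (N + 1) → ℕ, (∀ a, k a ≤ d + 1) →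
      fW (wedge ℂ (d + 1) k) =
        ∑ α, ((d + 1 - k α : ℕ) : ℂ) • wedge ℂ (d + 1) (Function.update k α (k α + 1)))
    (eV fV : ↥(⋀[ℂ]^N (Sym' ℂ d)) →ₗ[ℂ] ↥(⋀[ℂ]^N (Sym' ℂ d)))
    (heV : ∀ k : Fin N → ℕ, (∀ a, k a ≤ d) →
      eV (wedge ℂ d k) = ∑ α, (k α : ℂ) • wedge ℂ d (Function.update k α (k α - 1)))
    (hfV : ∀ k : Fin N → ℕ, (∀ a, k a ≤ d) →
      fV (wedge ℂ d k) = ∑ α, ((d - k α : ℕ) : ℂ) • wedge ℂ d (Function.update k α (k α + 1)))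
    (eSd fSd : Sym' ℂ d →ₗ[ℂ] Sym' ℂ d)
    (heSd : ∀ j ≤ d, eSd (XY ℂ d j) = (j : ℂ) • XY ℂ d (j - 1))
    (hfSd : ∀ j ≤ d, fSd (XY ℂ d j) = ((d - j : ℕ) : ℂ) • XY ℂ d (j + 1))
    (φ : Dom ℂ N d →ₗ[ℂ] Cod ℂ N d)
    (hφ : ∀ s < N, ∀ k : Fin (N + 1) → ℕ, StrictMono k → (∀ a, k a ≤ d + 1) →
      φ (XY ℂ (N - 1) s ⊗ₜ[ℂ] wedge ℂ (d + 1) k) = vv ℂ d N s k) :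
    (∀ x : Dom ℂ N d,
      φ (((TensorProduct.map eS LinearMap.id + TensorProduct.map LinearMap.id eW :
            Dom ℂ N d →ₗ[ℂ] Dom ℂ N d)) x) =
        ((TensorProduct.map eV LinearMap.id + TensorProduct.map LinearMap.id eSd :
            Cod ℂ N d →ₗ[ℂ] Cod ℂ N d)) (φ x)) ∧
    (∀ x : Dom ℂ N d,
      φ (((TensorProduct.map fS LinearMap.id + TensorProduct.map LinearMap.id fW :
            Dom ℂ N d →ₗ[ℂ] Dom ℂ N d)) x) =
        ((TensorProduct.map fV LinearMap.id + TensorProduct.map LinearMap.id fSd :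
            Cod ℂ N d →ₗ[ℂ] Cod ℂ N d)) (φ x)) := by
  constructor
  · intro x
    refine LinearMap.congr_fun (dom_ext N d
      (φ ∘ₗ (TensorProduct.map eS LinearMap.id + TensorProduct.map LinearMap.id eW :
            Dom ℂ N d →ₗ[ℂ] Dom ℂ N d))
      ((TensorProduct.map eV LinearMap.id + TensorProduct.map LinearMap.id eSd :
            Cod ℂ N d →ₗ[ℂ] Cod ℂ N d) ∘ₗ φ) hN ?_) x
    intro s hs k hk hd
    rw [LinearMap.comp_apply, LinearMap.comp_apply, hφ s hs k hk hd]
    exact main_e N d hN eS heS eW heW eV heV eSd heSd φ hφ s hs k hk hd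
  · intro x
    refine LinearMap.congr_fun (dom_ext N d
      (φ ∘ₗ (TensorProduct.map fS LinearMap.id + TensorProduct.map LinearMap.id fW :
            Dom ℂ N d →ₗ[ℂ] Dom ℂ N d))
      ((TensorProduct.map fV LinearMap.id + TensorProduct.map LinearMap.id fSd :
            Cod ℂ N d →ₗ[ℂ] Cod ℂ N d) ∘ₗ φ) hN ?_) x
    intro s hs k hk hd
    rw [LinearMap.comp_apply, LinearMap.comp_apply, hφ s hs k hk hd]
    exact main_f N d hN fS hfS fW hfW fV hfV fSd hfSd φ hφ s hs k hk hd

end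
end

section
/- Let s ∈ {0,1,…,N−1} and let k ∈ I(d+1,N+1) be strictly increasing. In the expression of v_{(s,k)} as a linear combination of the basis elements F_Δ(i,j), where (i,j) ranges over semistandard pairs, at most one pair (i,j) of any given content has a nonzero coefficient. -/
open MvPolynomial TensorProduct

set_option maxHeartbeats 1000000
set_option synthInstance.maxHeartbeats 400000

noncomputable section

variable (F : Type*) [Field F]

/-- Linear functional extracting the coefficient of `X^(c-m) Y^m`. -/
def xiCoord (c m : ℕ) : Sym' F c →ₗ[F] F :=
  (MvPolynomial.lcoeff F (Finsupp.single (0 : Fin 2) (c - m) + Finsupp.single 1 m)).comp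
    (Submodule.subtype _)

lemma xiCoord_XY (c m j : ℕ) (hj : j ≤ c) :
    xiCoord F c m (XY F c j) = if m = j then 1 else 0 := by
  have h1 : ((X 0 : MvPolynomial (Fin 2) F) ^ (c - j) * X 1 ^ j) =
      monomial (Finsupp.single (0 : Fin 2) (c - j) + Finsupp.single 1 j) 1 := by
    rw [X_pow_eq_monomial, X_pow_eq_monomial, monomial_mul, one_mul]
  have h2 : xiCoord F c m (XY F c j) =
      coeff (Finsupp.single (0 : Fin 2) (c - m) + Finsupp.single 1 m)
      ((X 0 : MvPolynomial (Fin 2) F) ^ (c - j) * X 1 ^ j) := by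
    simp [xiCoord, XY, hj]
  rw [h2, h1, coeff_monomial]
  by_cases h : m = j
  · subst h; simp
  · rw [if_neg, if_neg h]
    intro h3
    have := DFunLike.congr_fun h3 1
    simp at this
    exact h this.symm

lemma strictMono_eq_of_range_subset {N : ℕ} {i i' : Fin N → ℕ} (hi : StrictMono i)
    (hi' : StrictMono i') (h : ∀ a, ∃ b, i b = i' a) : i' = i := by
  have h1 : Finset.univ.image i' ⊆ Finset.univ.image i := by
    intro x hx
    simp only [Finset.mem_image, Finset.mem_univ, true_and] at hx ⊢
    obtain ⟨a, rfl⟩ := hx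
    exact h a
  have h2 : Finset.univ.image i' = Finset.univ.image i := by
    apply Finset.eq_of_subset_of_card_le h1
    rw [Finset.card_image_of_injective _ hi.injective, Finset.card_image_of_injective _ hi'.injective]
  rw [← StrictMono.range_inj hi' hi]
  have := congrArg (fun s : Finset ℕ => (s : Set ℕ)) h2
  simpa using this

/-- Coordinate functional dual to `Fp`. -/
def pairCoord (d : ℕ) {N : ℕ} (T : (Fin N → ℕ) × ℕ) :
    ((⋀[F]^N (Sym' F d)) ⊗[F] (Sym' F d)) →ₗ[F] F :=
  (LinearMap.mul' F F).comp (TensorProduct.map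
    (exteriorPower.alternatingMapToDual F (Sym' F d) N (fun a => xiCoord F d (T.1 a)))
    (xiCoord F d T.2))

lemma pairCoord_Fp (d : ℕ) {N : ℕ} (T p : (Fin N → ℕ) × ℕ) (hT : StrictMono T.1)
    (hp : StrictMono p.1) (hpd : ∀ a, p.1 a ≤ d) (hj : p.2 ≤ d) :
    pairCoord F d T (Fp F d p.1 p.2) = if T = p then 1 else 0 := by
  have h1 : pairCoord F d T (Fp F d p.1 p.2) =
      Matrix.det (n := Fin N) (.of (fun a b => xiCoord F d (T.1 b) (XY F d (p.1 a)))) *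
        xiCoord F d T.2 (XY F d p.2) := by
    rw [← exteriorPower.alternatingMapToDual_apply_ιMulti
      (R := F) (fun a => xiCoord F d (T.1 a)) (fun a => XY F d (p.1 a))]
    rfl
  rw [h1, xiCoord_XY F d _ _ hj]
  by_cases h : T = p
  · subst h
    have : (Matrix.of (fun a b => xiCoord F d (T.1 b) (XY F d (T.1 a))) :
        Matrix (Fin N) (Fin N) F) = 1 := by
      ext a b
      simp only [Matrix.of_apply, xiCoord_XY F d _ _ (hpd a), Matrix.one_apply,
        hT.injective.eq_iff, eq_comm]
    simp [this]
  · rw [if_neg h]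
    by_cases h2 : T.2 = p.2
    · have h3 : ¬ ∀ a, ∃ b, T.1 b = p.1 a := by
        intro h3
        exact h (Prod.ext (strictMono_eq_of_range_subset hT hp h3).symm h2)
      push Not at h3
      obtain ⟨a, ha⟩ := h3
      rw [Matrix.det_eq_zero_of_row_eq_zero a, zero_mul]
      intro b
      simp [xiCoord_XY F d _ _ (hpd a), ha b]
    · simp [h2]

/-- The pair obtained from an increasing sequence by singling out the entry at `b`. -/
def tt {N : ℕ} (m : Fin (N + 1) → ℕ) (b : Fin (N + 1)) : (Fin N → ℕ) × ℕ :=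
  (m ∘ b.succAbove, m b)

lemma tt_mono {N : ℕ} {m : Fin (N + 1) → ℕ} (hm : StrictMono m) (b : Fin (N + 1)) :
    StrictMono (tt m b).1 := hm.comp (Fin.strictMono_succAbove b)

lemma tt_ne {N : ℕ} {m : Fin (N + 1) → ℕ} (hm : StrictMono m) (b : Fin (N + 1)) :
    ¬ ∃ a, (tt m b).1 a = (tt m b).2 := by
  rintro ⟨a, ha⟩
  exact Fin.succAbove_ne b a (hm.injective ha)

lemma Pmap_tt {N : ℕ} {m : Fin (N + 1) → ℕ} (hm : StrictMono m) (b : Fin N) :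
    Pmap (tt m b.succ) = tt m b.castSucc := by
  have hle : ∀ a : Fin N, (tt m b.succ).1 a ≤ (tt m b.succ).2 ↔ a ≤ b := by
    intro a
    simp only [tt, Function.comp_apply, hm.le_iff_le]
    simp only [Fin.succAbove, Fin.lt_def, Fin.le_def]
    split_ifs with h <;> simp at h ⊢ <;> omega
  have hne : (Finset.univ.filter fun a : Fin N => (tt m b.succ).1 a ≤ (tt m b.succ).2).Nonempty :=
    ⟨b, by simp [hle]⟩
  have hmax : (Finset.univ.filter fun a : Fin N => (tt m b.succ).1 a ≤ (tt m b.succ).2).max' hne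
      = b := by
    rw [Finset.max'_eq_iff]
    simp [hle]
  unfold Pmap
  rw [dif_pos hne]
  simp only [hmax]
  refine Prod.ext ?_ ?_
  · funext a
    by_cases hab : a = b
    · subst hab; simp [tt]
    · simp only [tt, Function.update_of_ne hab, Function.comp_apply]
      congr 1
      simp only [Fin.succAbove, Fin.lt_def, Fin.ext_iff] at hab ⊢
      split_ifs with h1 h2 h2 <;> simp at h1 h2 ⊢ <;> omega
  · simp [tt]

lemma tt_content {N : ℕ} (m : Fin (N + 1) → ℕ) (b : Fin (N + 1)) :
    ssContent (tt m b) = Finset.univ.val.map m := by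
  rw [Fin.univ_succAbove N b]
  simp [ssContent, tt]

lemma eq_of_map_eq {N : ℕ} {m m' : Fin N → ℕ} (hm : StrictMono m) (hm' : StrictMono m')
    (h : (Finset.univ.val.map m : Multiset ℕ) = Finset.univ.val.map m') : m = m' := by
  refine strictMono_eq_of_range_subset hm' hm fun a => ?_
  have : m a ∈ (Finset.univ.val.map m : Multiset ℕ) := by simp
  rw [h] at this
  simpa using this

lemma tt_inj {N : ℕ} {m m' : Fin (N + 1) → ℕ} (hm : StrictMono m) (hm' : StrictMono m')
    {b b' : Fin (N + 1)} (h : tt m b = tt m' b') : m = m' ∧ b = b' := by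
  have h1 := congrArg ssContent h
  rw [tt_content, tt_content] at h1
  have h2 := eq_of_map_eq hm hm' h1
  subst h2
  exact ⟨rfl, hm.injective (congrArg Prod.snd h)⟩

lemma exists_tt {N : ℕ} (p : (Fin N → ℕ) × ℕ) (hp : StrictMono p.1)
    (hne : ¬ ∃ a, p.1 a = p.2) : ∃ m b, StrictMono m ∧ p = tt m b := by
  obtain ⟨i, j⟩ := p
  simp only at hp hne
  have hj : j ∉ Finset.univ.image i := by simpa using hne
  have hcard : (insert j (Finset.univ.image i)).card = N + 1 := by
    rw [Finset.card_insert_of_notMem hj, Finset.card_image_of_injective _ hp.injective]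
    simp
  set m := (insert j (Finset.univ.image i)).orderEmbOfFin hcard with hmdef
  have hr : Set.range m = insert j (Finset.univ.image i) := by
    simp [hmdef]
  have hmem : j ∈ Set.range m := by rw [hr]; simp
  obtain ⟨b, hb⟩ := hmem
  refine ⟨m, b, m.strictMono, ?_⟩
  refine Prod.ext ?_ hb.symm
  refine strictMono_eq_of_range_subset (tt_mono m.strictMono b) hp fun a => ?_
  have : i a ∈ Set.range m := by rw [hr]; simp
  obtain ⟨x, hx⟩ := this
  have hxb : x ≠ b := by
    rintro rfl
    exact hne ⟨a, by rw [← hx, hb]⟩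
  obtain ⟨y, hy⟩ := Fin.exists_succAbove_eq hxb
  exact ⟨y, by simp [tt, hy, hx]⟩

lemma eq_of_content_deg {N : ℕ} (p q : (Fin N → ℕ) × ℕ) (hp : StrictMono p.1)
    (hq : StrictMono q.1) (hdeg : ∃ a, p.1 a = p.2) (h : ssContent p = ssContent q) : p = q := by
  have hj : p.2 = q.2 := by
    by_contra hne
    have h1 := congrArg (Multiset.count p.2) h
    have h2 : 1 ≤ Multiset.count p.2 (Finset.univ.val.map p.1) := by
      rw [Multiset.one_le_count_iff_mem]; simpa using hdeg
    have h3 : Multiset.count p.2 (Finset.univ.val.map q.1) ≤ 1 :=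
      Multiset.nodup_iff_count_le_one.1 (Finset.univ.nodup.map hq.injective) _
    rw [ssContent, ssContent, Multiset.count_cons_self, Multiset.count_cons_of_ne hne] at h1
    omega
  have h' := h
  rw [ssContent, ssContent, hj, Multiset.cons_inj_right] at h'
  exact Prod.ext (eq_of_map_eq hp hq h') hj

open Classical in
lemma alt_lemma (N : ℕ) (C : ℕ → F) (R : ℕ → Prop)
    (hC : ∀ b, C b + C (b + 1) = if R b then 1 else 0) (hlast : ∀ b, N < b → C b = 0)
    (huniq : ∀ a b, a < b → R a → R b → b = a + 1)
    (hext : ∀ b, R b → R (b + 1) ∨ ∃ a, b = a + 1 ∧ R a) :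
    ∀ b, (C b = if (R b ∧ ∃ a, b = a + 1 ∧ R a) then 1 else 0) := by
  have key : ∀ t b, N + 1 ≤ b + t →
      (C b = if (R b ∧ ∃ a, b = a + 1 ∧ R a) then 1 else 0) := by
    intro t
    induction t with
    | zero =>
      intro b hb
      have h1 := hC b
      rw [hlast b (by omega), hlast (b + 1) (by omega)] at h1
      have : ¬ R b := by
        intro h
        simp [h] at h1
      rw [if_neg (by tauto), hlast b (by omega)]
    | succ t ih =>
      intro b hb
      have h1 := hC b
      rw [ih (b + 1) (by omega)] at h1
      have e : (∃ a, b + 1 = a + 1 ∧ R a) ↔ R b := by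
        constructor
        · rintro ⟨a, ha, hR⟩
          obtain rfl : b = a := by omega
          exact hR
        · exact fun h => ⟨b, rfl, h⟩
      rw [e] at h1
      by_cases hb : R b
      · by_cases ha : ∃ a, b = a + 1 ∧ R a
        · have h2 : ¬ R (b + 1) := by
            intro h2
            obtain ⟨a, rfl, h3⟩ := ha
            have := huniq a (a + 1 + 1) (by omega) h3 h2
            omega
          rw [if_pos ⟨hb, ha⟩]
          simpa [h2, hb] using h1
        · have h2 : R (b + 1) := (hext b hb).resolve_right ha
          rw [if_neg (fun h => ha h.2)]
          simpa [h2, hb] using h1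
      · rw [if_neg (by tauto)]
        simpa [hb] using h1
  exact fun b => key (N + 1) b (by omega)

lemma box_mem {N : ℕ} {k : Fin (N + 1) → ℕ} {i : Fin N → ℕ} :
    i ∈ box k ↔ ∀ a, k a.castSucc ≤ i a ∧ i a < k a.succ := by
  simp [box]

lemma box_mono {N : ℕ} {k : Fin (N + 1) → ℕ} (hk : StrictMono k) {i : Fin N → ℕ}
    (hi : i ∈ box k) : StrictMono i := by
  rw [box_mem] at hi
  intro a b hab
  calc i a < k a.succ := (hi a).2
    _ ≤ k b.castSucc := hk.monotone (by
      rw [Fin.lt_def] at hab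
      rw [Fin.le_def]
      simp
      omega)
    _ ≤ i b := (hi b).1

/-- sums over the box: the second index lies between the extreme values of `k`. -/
lemma box_sum {N s : ℕ} (hs : s < N) {k : Fin (N + 1) → ℕ} {i : Fin N → ℕ}
    (hi : i ∈ box k) :
    k 0 + N + ∑ a, i a ≤ s + ∑ a, k a ∧
    s + ∑ a, k a < k (Fin.last N) + N + ∑ a, i a := by
  rw [box_mem] at hi
  have h1 : ∑ a : Fin N, k a.castSucc ≤ ∑ a, i a := Finset.sum_le_sum fun a _ => (hi a).1
  have h2 : ∑ a, (i a + 1) ≤ ∑ a : Fin N, k a.succ := Finset.sum_le_sum fun a _ => (hi a).2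
  rw [Finset.sum_add_distrib] at h2
  simp at h2
  have h3 := Fin.sum_univ_succ k
  have h4 := Fin.sum_univ_castSucc k
  omega

lemma tt_box {N : ℕ} {k m : Fin (N + 1) → ℕ} {b : Fin (N + 1)} :
    (tt m b).1 ∈ box k ↔
      ∀ a : ℕ, ∀ ha : a < N,
        (a < b → k ⟨a, by omega⟩ ≤ m ⟨a, by omega⟩ ∧ m ⟨a, by omega⟩ < k ⟨a + 1, by omega⟩) ∧
        (b ≤ a → k ⟨a, by omega⟩ ≤ m ⟨a + 1, by omega⟩ ∧
          m ⟨a + 1, by omega⟩ < k ⟨a + 1, by omega⟩) := by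
  rw [box_mem]
  constructor
  · intro h a ha
    have := h ⟨a, ha⟩
    simp only [tt, Function.comp_apply, Fin.succAbove, Fin.lt_def] at this
    constructor
    · intro hab
      rw [if_pos (by simpa using hab)] at this
      exact this
    · intro hab
      rw [if_neg (by simpa using hab)] at this
      exact this
  · intro h a
    have := h a a.2
    simp only [tt, Function.comp_apply, Fin.succAbove, Fin.lt_def]
    split_ifs with hab
    · exact this.1 (by simpa using hab)
    · exact this.2 (by simpa using hab)

/-- `tt m b` occurs in `vv`. -/
def InV {N : ℕ} (s : ℕ) (k m : Fin (N + 1) → ℕ) (b : ℕ) : Prop :=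
  ∃ h : b < N + 1, (tt m ⟨b, h⟩).1 ∈ box k ∧ N + ∑ a, m a = s + ∑ a, k a

lemma InV_uniq {N s : ℕ} {k m : Fin (N + 1) → ℕ} (a b : ℕ) (hab : a < b)
    (ha : InV s k m a) (hb : InV s k m b) : b = a + 1 := by
  obtain ⟨h1, h2, -⟩ := ha
  obtain ⟨h3, h4, -⟩ := hb
  rw [tt_box] at h2 h4
  by_contra hne
  have h5 := (h2 a (by omega)).2 le_rfl
  have h6 := (h4 (a + 1) (by omega)).1 (by simp; omega)
  omega

lemma tt_sum {N : ℕ} (m : Fin (N + 1) → ℕ) (b : Fin (N + 1)) :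
    ∑ a, m a = m b + ∑ a, (tt m b).1 a := by
  rw [Fin.sum_univ_succAbove m b]; rfl

lemma InV_ext {N s : ℕ} (hs : s < N) {k m : Fin (N + 1) → ℕ} (hm : StrictMono m)
    (b : ℕ) (hb : InV s k m b) :
    InV s k m (b + 1) ∨ ∃ a, b = a + 1 ∧ InV s k m a := by
  obtain ⟨hbN, hbox, hsum⟩ := hb
  obtain ⟨hl, hu⟩ := box_sum hs hbox
  have hts := tt_sum m ⟨b, hbN⟩
  have hl' : k 0 ≤ m ⟨b, hbN⟩ := by omega
  have hu' : m ⟨b, hbN⟩ < k (Fin.last N) := by omega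
  rw [tt_box] at hbox
  by_cases hc : m ⟨b, hbN⟩ < k ⟨b, hbN⟩
  · right
    obtain _ | a := b
    · exact absurd hc (not_lt.2 hl')
    refine ⟨a, rfl, by omega, ?_, hsum⟩
    rw [tt_box]
    intro x hx
    refine ⟨fun hxa => (hbox x hx).1 (by simp at hxa ⊢; omega), fun hxa => ?_⟩
    simp only at hxa
    rcases hxa.eq_or_lt with rfl | hlt
    · have h1 := (hbox a hx).1 (by simp)
      have h2 : m ⟨a, by omega⟩ < m ⟨a + 1, hbN⟩ := hm (by simp [Fin.lt_def])
      exact ⟨by omega, hc⟩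
    · exact (hbox x hx).2 (by simp; omega)
  · left
    have hbN' : b < N := by
      by_contra h
      obtain rfl : b = N := by omega
      exact hc hu'
    refine ⟨by omega, ?_, hsum⟩
    rw [tt_box]
    intro x hx
    refine ⟨fun hxa => ?_, fun hxa => (hbox x hx).2 (by simp at hxa ⊢; omega)⟩
    simp only at hxa
    rcases (Nat.lt_succ_iff.1 hxa).eq_or_lt with rfl | hlt
    · have h1 := (hbox x hx).2 (by simp)
      have h2 : m ⟨x, hbN⟩ < m ⟨x + 1, by omega⟩ := hm (by simp [Fin.lt_def])
      exact ⟨by omega, by omega⟩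
    · exact (hbox x hx).1 (by simpa using hlt)

open Classical in
lemma pairCoord_vv (N d s : ℕ) (hs : s < N) (k : Fin (N + 1) → ℕ)
    (hk : StrictMono k) (hk' : ∀ a, k a ≤ d + 1) (m : Fin (N + 1) → ℕ) (hm : StrictMono m)
    (b : Fin (N + 1)) :
    pairCoord F d (tt m b) (vv F d N s k) = if InV s k m b then 1 else 0 := by
  have h1 : ∀ i ∈ box k, pairCoord F d (tt m b) (Fp F d i (s + (∑ a, k a) - N - ∑ a, i a)) =
      if (tt m b).1 = i then (if InV s k m b then 1 else 0) else 0 := by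
    intro i hi
    obtain ⟨hl, hu⟩ := box_sum hs hi
    have hlast := hk' (Fin.last N)
    have hi' := box_mem.1 hi
    rw [pairCoord_Fp F d (tt m b) (i, s + (∑ a, k a) - N - ∑ a, i a) (tt_mono hm b)
      (box_mono hk hi) (fun a => by have := (hi' a).2; have := hk' a.succ; simp only; omega)
      (by simp only; omega)]
    by_cases h : (tt m b).1 = i
    · subst h
      have hts := tt_sum m b
      rw [if_pos rfl]
      congr 1
      rw [eq_iff_iff]
      constructor
      · intro h
        have h2 : m b = _ := congrArg Prod.snd h
        refine ⟨b.2, hi, ?_⟩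
        simp only at h2
        omega
      · rintro ⟨-, -, h⟩
        refine Prod.ext rfl ?_
        change m b = _
        simp only
        omega
    · rw [if_neg h, if_neg]
      intro h2
      exact h (congrArg Prod.fst h2)
  rw [vv, map_sum, Finset.sum_congr rfl h1, Finset.sum_ite_eq]
  split_ifs with h2 h3 h3
  · rfl
  · rfl
  · exact absurd h3.2.1 h2
  · rfl

open Classical in
lemma pairCoord_FDelta (N d : ℕ) (p : (Fin N → ℕ) × ℕ) (hp : IsSS d p) (hN : 0 < N)
    (m : Fin (N + 1) → ℕ) (hm : StrictMono m) (b : ℕ) (hb : b < N + 1) :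
    pairCoord F d (tt m ⟨b, hb⟩) (FDelta F d p) =
      (if p = tt m ⟨b, hb⟩ then 1 else 0) +
      (if ∃ h : b + 1 < N + 1, p = tt m ⟨b + 1, h⟩ then 1 else 0) := by
  obtain ⟨h1, h2, h3, h4⟩ := hp
  unfold FDelta
  by_cases hdeg : ∃ a, p.1 a = p.2
  · rw [if_pos hdeg, pairCoord_Fp F d _ p (tt_mono hm _) h1 h2 h3]
    rw [if_neg (c := ∃ h : b + 1 < N + 1, p = tt m ⟨b + 1, h⟩)]
    · simp [eq_comm]
    · rintro ⟨h, rfl⟩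
      exact tt_ne hm _ hdeg
  · rw [if_neg hdeg]
    obtain ⟨m', b', hm', rfl⟩ := exists_tt p h1 hdeg
    have hb0 : b' ≠ 0 := by
      rintro rfl
      obtain _ | N := N
      · omega
      have := h4 0 rfl
      simp only [tt, Function.comp_apply, hm'.le_iff_le] at this
      simp at this
    obtain ⟨e, rfl⟩ := Fin.exists_succ_eq.2 hb0
    have hd : ∀ x, m' x ≤ d := by
      intro x
      by_cases hx : x = e.succ
      · subst hx; exact h3
      · obtain ⟨y, rfl⟩ := Fin.exists_succAbove_eq hx
        exact h2 y
    rw [map_add, Pmap_tt hm', pairCoord_Fp F d _ _ (tt_mono hm _) h1 h2 h3,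
      pairCoord_Fp F d _ _ (tt_mono hm _) (tt_mono hm' _) (fun _ => hd _) (hd _)]
    congr 1
    · simp [eq_comm]
    · congr 1
      rw [eq_iff_iff]
      constructor
      · intro h
        obtain ⟨rfl, h6⟩ := tt_inj hm hm' h
        have h7 : b = e := congrArg Fin.val h6
        subst h7
        exact ⟨by omega, rfl⟩
      · rintro ⟨h5, h⟩
        obtain ⟨rfl, h6⟩ := tt_inj hm' hm h
        have h7 : (e : ℕ) + 1 = b + 1 := congrArg Fin.val h6
        congr 1
        ext
        simp
        omega

/-- Lemma 2.13 of the paper. In the expression of `v_{(s,k)}` as a linear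
combination of the basis elements `F_Δ(i,j)` over semistandard pairs `(i,j)`, at most one pair
of any given content has a nonzero coefficient. -/
theorem statement15 (F : Type*) [Field F] (N d : ℕ) (hN : 0 < N)
    (s : ℕ) (hs : s < N) (k : Fin (N + 1) → ℕ)
    (hk : StrictMono k) (hk' : ∀ a, k a ≤ d + 1)
    (c : ((Fin N → ℕ) × ℕ) →₀ F)
    (hsupp : ∀ p ∈ c.support, IsSS d p)
    (hrep : (c.sum fun p r => r • FDelta F d p) = vv F d N s k) :
    ∀ p q, c p ≠ 0 → c q ≠ 0 → ssContent p = ssContent q → p = q := by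
  classical
  have hss : ∀ p, c p ≠ 0 → IsSS d p := fun p hp => hsupp p (Finsupp.mem_support_iff.2 hp)
  intro p q hp hq hpq
  by_cases hpd : ∃ a, p.1 a = p.2
  · exact eq_of_content_deg p q (hss p hp).1 (hss q hq).1 hpd hpq
  by_cases hqd : ∃ a, q.1 a = q.2
  · exact (eq_of_content_deg q p (hss q hq).1 (hss p hp).1 hqd hpq.symm).symm
  obtain ⟨m, b, hm, rfl⟩ := exists_tt p (hss p hp).1 hpd
  obtain ⟨m', b', hm', rfl⟩ := exists_tt q (hss q hq).1 hqd
  rw [tt_content, tt_content] at hpq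
  obtain rfl := eq_of_map_eq hm hm' hpq
  set C : ℕ → F := fun b => if h : b < N + 1 then c (tt m ⟨b, h⟩) else 0 with hCdef
  have hC : ∀ b, C b + C (b + 1) = if InV s k m b then 1 else 0 := by
    intro b
    by_cases hb : b < N + 1
    · rw [← pairCoord_vv F N d s hs k hk hk' m hm ⟨b, hb⟩, ← hrep, Finsupp.sum, map_sum]
      have h1 : ∀ p ∈ c.support, pairCoord F d (tt m ⟨b, hb⟩) (c p • FDelta F d p) =
          (if p = tt m ⟨b, hb⟩ then c p else 0) +
          (if ∃ h : b + 1 < N + 1, p = tt m ⟨b + 1, h⟩ then c p else 0) := by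
        intro p hp
        rw [map_smul, pairCoord_FDelta F N d p (hsupp p hp) hN m hm b hb]
        simp [mul_add]
      rw [Finset.sum_congr rfl h1, Finset.sum_add_distrib]
      congr 1
      · rw [Finset.sum_ite_eq']
        simp only [hCdef, dif_pos hb]
        split_ifs with h
        · rfl
        · exact Finsupp.notMem_support_iff.1 h
      · by_cases hb1 : b + 1 < N + 1
        · simp only [hCdef, dif_pos hb1, hb1, exists_true_left]
          rw [Finset.sum_ite_eq']
          split_ifs with h
          · rfl
          · exact Finsupp.notMem_support_iff.1 h
        · have h2 : C (b + 1) = 0 := dif_neg hb1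
          rw [h2, Finset.sum_eq_zero]
          intro x _
          exact if_neg (fun h => hb1 h.1)
    · rw [if_neg (fun h => hb h.1)]
      have h1 : C b = 0 := dif_neg hb
      have h2 : C (b + 1) = 0 := dif_neg (by omega)
      rw [h1, h2, add_zero]
  have key := alt_lemma F N C (InV s k m) hC (fun b hb => dif_neg (by omega))
    InV_uniq (InV_ext hs hm)
  have hkey : ∀ b : Fin (N + 1), c (tt m b) ≠ 0 →
      InV s k m b ∧ ∃ a, (b : ℕ) = a + 1 ∧ InV s k m a := by
    intro b hb
    have h1 := key b
    by_contra hne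
    rw [if_neg hne] at h1
    simp only [hCdef, dif_pos b.2] at h1
    exact hb h1
  obtain ⟨h1, a, h2, h3⟩ := hkey b hp
  obtain ⟨h1', a', h2', h3'⟩ := hkey b' hq
  have : b = b' := by
    ext
    rcases lt_trichotomy (b : ℕ) b' with h | h | h
    · have := InV_uniq a b' (by omega) h3 h1'
      omega
    · exact h
    · have := InV_uniq a' b (by omega) h3' h1
      omega
  rw [this]

end
end
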